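/- arXiv:1704.05580 — 2 statements merged into one kernel-verified Lean document; each statement's English description precedes it below -/
import Mathlib

section
/- Let d ≥ 1, T > 0 and 0 < β ≤ 1, and let K(t,x) := (4πt)^{−d/2} e^{−|x|²/(4t)} be the Gaussian heat kernel on (0,∞)×ℝ^d. Then there is a constant N = N(d,T,β) such that for all 0 < s < t ≤ T: ∫_0^s ( ∫_{ℝ^d} |K(t−r,z) − K(s−r,z)|·(1 + |z|^β) dz )² dr ≤ N·(t − s). -/
open MeasureTheory Real Set Filter
open scoped ENNReal NNReal Topology

noncomputable section

abbrev Ed (d : ℕ) : Type := ℝ × EuclideanSpace ℝ (Fin d)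

/-- Parabolic distance on `ℝ × ℝ^d`. -/
def pdist {d : ℕ} (X Y : Ed d) : ℝ :=
  max (dist X.2 Y.2) (Real.sqrt |X.1 - Y.1|)

/-- Parabolic cylinder of radius `c` centered at `X`. -/
def pcyl {d : ℕ} (X : Ed d) (c : ℝ) : Set (Ed d) := {Y | pdist X Y < c}

/-- Diameter of `D` with respect to the parabolic distance. -/
def pdiam {d : ℕ} (D : Set (Ed d)) : ℝ :=
  sSup {r | ∃ X ∈ D, ∃ Y ∈ D, pdist X Y = r}

/-- `D(X,ρ) = D ∩ Q_ρ(X)`. -/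
def cylD {d : ℕ} (D : Set (Ed d)) (X : Ed d) (ρ : ℝ) : Set (Ed d) := D ∩ pcyl X ρ

/-- Mean value `u_{X,ρ}` of `u` over `D(X,ρ)`. -/
def meanVal {d : ℕ} (D : Set (Ed d)) (u : Ed d → ℝ) (X : Ed d) (ρ : ℝ) : ℝ :=
  ((volume (cylD D X ρ)).toReal)⁻¹ * ∫ Y in cylD D X ρ, u Y

/-- The local Campanato mean oscillation `|D(X,ρ)|^{-θ} ∫_{D(X,ρ)} |u - u_{X,ρ}|^p`. -/
def campOsc {d : ℕ} (D : Set (Ed d)) (u : Ed d → ℝ) (p θ : ℝ) (X : Ed d) (ρ : ℝ) : ℝ≥0∞ :=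
  volume (cylD D X ρ) ^ (-θ) *
    ∫⁻ Y in cylD D X ρ, ENNReal.ofReal (|u Y - meanVal D u X ρ| ^ p)

/-- The Campanato seminorm `[u]_{𝓛^{p,θ}(D;δ)}`. -/
def campSemi {d : ℕ} (D : Set (Ed d)) (u : Ed d → ℝ) (p θ : ℝ) : ℝ≥0∞ :=
  (⨆ X ∈ D, ⨆ ρ ∈ Set.Ioc (0:ℝ) (pdiam D), campOsc D u p θ X ρ) ^ (1/p)

/-- `D` is of `A`-type: `|D(X,ρ)| ≥ A |Q_ρ(X)|`. -/
def AType {d : ℕ} (D : Set (Ed d)) (A : ℝ) : Prop :=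
  ∀ X ∈ D, ∀ ρ : ℝ, 0 < ρ → ρ ≤ pdiam D →
    ENNReal.ofReal A * volume (pcyl X ρ) ≤ volume (cylD D X ρ)

/-- The set of Hölder quotients `|u X - u Y| / δ(X,Y)^α`. -/
def holderSet {d : ℕ} (D : Set (Ed d)) (u : Ed d → ℝ) (α : ℝ) : Set ℝ :=
  {v | ∃ X ∈ D, ∃ Y ∈ D, X ≠ Y ∧ v = |u X - u Y| / pdist X Y ^ α}

/-- The Gaussian heat kernel on `(0,∞) × ℝ^d`. -/
def heatK (d : ℕ) (t : ℝ) (x : EuclideanSpace ℝ (Fin d)) : ℝ :=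
  (4 * Real.pi * t) ^ (-(d : ℝ) / 2) * Real.exp (-‖x‖ ^ 2 / (4 * t))


/-- A wider Gaussian, with the normalisation of `heatK`, that dominates the heat kernel against
polynomial weights. -/
def wideGauss (d : ℕ) (τ : ℝ) (z : EuclideanSpace ℝ (Fin d)) : ℝ :=
  (4 * π * τ) ^ (-(d : ℝ) / 2) * exp (-(1 / (16 * τ)) * ‖z‖ ^ 2)

lemma integrable_wideGauss (d : ℕ) {τ : ℝ} (hτ : 0 < τ) : Integrable (wideGauss d τ) := by
  have hb : 0 < 1 / (16 * τ) := by positivity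
  have h : Integrable fun z : EuclideanSpace ℝ (Fin d) => exp (-(1 / (16 * τ)) * ‖z‖ ^ 2) := by
    by_contra hn
    have h0 := GaussianFourier.integral_rexp_neg_mul_sq_norm
      (V := EuclideanSpace ℝ (Fin d)) hb
    rw [integral_undef hn] at h0
    have : 0 < (π / (1 / (16 * τ))) ^ (Module.finrank ℝ (EuclideanSpace ℝ (Fin d)) / 2 : ℝ) := by
      positivity
    linarith
  exact h.const_mul _

lemma integral_wideGauss (d : ℕ) {τ : ℝ} (hτ : 0 < τ) :
    ∫ z, wideGauss d τ z = (4 : ℝ) ^ ((d : ℝ) / 2) := by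
  have hb : 0 < 1 / (16 * τ) := by positivity
  unfold wideGauss
  rw [integral_const_mul, GaussianFourier.integral_rexp_neg_mul_sq_norm hb,
    finrank_euclideanSpace, Fintype.card_fin, neg_div, rpow_neg (by positivity)]
  have h : π / (1 / (16 * τ)) = 4 * (4 * π * τ) := by field_simp; ring
  have h0 : (0 : ℝ) < 4 * π * τ := by positivity
  rw [h, mul_rpow (by norm_num) h0.le, mul_left_comm, inv_mul_cancel₀ (rpow_pos_of_pos h0 _).ne',
    mul_one]

lemma one_add_rpow_le_exp {T β u x : ℝ} (hβ0 : 0 < β) (hβ1 : β ≤ 1) (hu : 0 < u) (huT : u ≤ T)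
    (hx : 0 ≤ x) : 1 + x ^ β ≤ 32 * (1 + T) * exp (x ^ 2 / (32 * u)) := by
  have h1 : x ^ β ≤ 1 + x ^ 2 := by
    rcases le_total x 1 with h | h
    · nlinarith [rpow_le_one hx h hβ0.le, sq_nonneg x]
    · have := rpow_le_rpow_of_exponent_le h hβ1
      rw [rpow_one] at this
      nlinarith
  have hy : 0 ≤ x ^ 2 / (32 * u) := by positivity
  have hxy : x ^ 2 = 32 * u * (x ^ 2 / (32 * u)) := by field_simp
  have he := add_one_le_exp (x ^ 2 / (32 * u))
  have hT : 0 < T := hu.trans_le huT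
  generalize x ^ 2 / (32 * u) = y at *
  have : u * y ≤ T * y := by gcongr
  nlinarith [mul_le_mul_of_nonneg_left he (by linarith : 0 ≤ 1 + T)]

lemma heatK_nonneg (d : ℕ) {τ : ℝ} (hτ : 0 < τ) (z : EuclideanSpace ℝ (Fin d)) :
    0 ≤ heatK d τ z := by
  unfold heatK; positivity

lemma heatK_mul_weight_le (d : ℕ) {T β τ : ℝ} (hβ0 : 0 < β) (hβ1 : β ≤ 1) (hτ : 0 < τ)
    (hτT : τ ≤ T) (z : EuclideanSpace ℝ (Fin d)) :
    heatK d τ z * (1 + ‖z‖ ^ β) ≤ 32 * (1 + T) * wideGauss d τ z := by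
  have hw := one_add_rpow_le_exp hβ0 hβ1 hτ hτT (norm_nonneg z)
  have hT : 0 < T := hτ.trans_le hτT
  have he : exp (-‖z‖ ^ 2 / (4 * τ)) * exp (‖z‖ ^ 2 / (32 * τ))
      ≤ exp (-(1 / (16 * τ)) * ‖z‖ ^ 2) := by
    rw [← exp_add, exp_le_exp]
    have hy : 0 ≤ ‖z‖ ^ 2 / (32 * τ) := by positivity
    have h1 : -‖z‖ ^ 2 / (4 * τ) = -8 * (‖z‖ ^ 2 / (32 * τ)) := by field_simp; ring
    have h2 : -(1 / (16 * τ)) * ‖z‖ ^ 2 = -2 * (‖z‖ ^ 2 / (32 * τ)) := by field_simp; ring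
    rw [h1, h2]; linarith
  calc heatK d τ z * (1 + ‖z‖ ^ β)
      ≤ heatK d τ z * (32 * (1 + T) * exp (‖z‖ ^ 2 / (32 * τ))) :=
        mul_le_mul_of_nonneg_left hw (heatK_nonneg d hτ z)
    _ = 32 * (1 + T) * ((4 * π * τ) ^ (-(d : ℝ) / 2) *
          (exp (-‖z‖ ^ 2 / (4 * τ)) * exp (‖z‖ ^ 2 / (32 * τ)))) := by unfold heatK; ring
    _ ≤ 32 * (1 + T) * wideGauss d τ z := by unfold wideGauss; gcongr

lemma hasDerivAt_heatK (d : ℕ) {τ : ℝ} (hτ : 0 < τ) (z : EuclideanSpace ℝ (Fin d)) :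
    HasDerivAt (fun τ => heatK d τ z)
      ((‖z‖ ^ 2 / (4 * τ ^ 2) - d / (2 * τ)) * heatK d τ z) τ := by
  have h1 : HasDerivAt (fun τ : ℝ => 4 * π * τ) (4 * π) τ := by
    simpa using (hasDerivAt_id τ).const_mul (4 * π)
  have hne : 4 * π * τ ≠ 0 := by positivity
  have h2 := h1.rpow_const (p := -(d : ℝ) / 2) (Or.inl hne)
  have h3 : HasDerivAt (fun τ : ℝ => -‖z‖ ^ 2 / (4 * τ)) (‖z‖ ^ 2 / (4 * τ ^ 2)) τ := by
    have := (hasDerivAt_const τ (-‖z‖ ^ 2)).div ((hasDerivAt_id τ).const_mul 4)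
      (by simpa using hτ.ne')
    refine this.congr_deriv ?_
    simp only [id]
    field_simp
    norm_num
  refine (h2.mul h3.exp).congr_deriv ?_
  rw [rpow_sub_one hne]
  unfold heatK
  field_simp
  ring

lemma abs_deriv_heatK_le (d : ℕ) {u τ : ℝ} (hu : 0 < u) (h1 : u ≤ τ) (h2 : τ ≤ 2 * u)
    (z : EuclideanSpace ℝ (Fin d)) :
    |(‖z‖ ^ 2 / (4 * τ ^ 2) - d / (2 * τ)) * heatK d τ z| ≤
      (‖z‖ ^ 2 / (4 * u ^ 2) + d / (2 * u)) *
        ((4 * π * u) ^ (-(d : ℝ) / 2) * exp (-‖z‖ ^ 2 / (8 * u))) := by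
  have hτ : 0 < τ := hu.trans_le h1
  rw [abs_mul, abs_of_nonneg (heatK_nonneg d hτ z)]
  have ha : |‖z‖ ^ 2 / (4 * τ ^ 2) - d / (2 * τ)| ≤ ‖z‖ ^ 2 / (4 * u ^ 2) + d / (2 * u) := by
    have hA : ‖z‖ ^ 2 / (4 * τ ^ 2) ≤ ‖z‖ ^ 2 / (4 * u ^ 2) := by gcongr
    have hB : (d : ℝ) / (2 * τ) ≤ d / (2 * u) := by gcongr
    have hA0 : 0 ≤ ‖z‖ ^ 2 / (4 * τ ^ 2) := by positivity
    have hB0 : 0 ≤ (d : ℝ) / (2 * τ) := by positivity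
    rw [abs_le]; constructor <;> linarith
  have hb : heatK d τ z ≤ (4 * π * u) ^ (-(d : ℝ) / 2) * exp (-‖z‖ ^ 2 / (8 * u)) := by
    unfold heatK
    have hp : (4 * π * τ) ^ (-(d : ℝ) / 2) ≤ (4 * π * u) ^ (-(d : ℝ) / 2) := by
      apply rpow_le_rpow_of_nonpos (by positivity) (by gcongr)
      have : (0 : ℝ) ≤ d := by positivity
      linarith
    have he : -‖z‖ ^ 2 / (4 * τ) ≤ -‖z‖ ^ 2 / (8 * u) := by
      rw [neg_div, neg_div, neg_le_neg_iff]
      exact div_le_div_of_nonneg_left (by positivity) (by positivity) (by linarith)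
    gcongr
  exact mul_le_mul ha hb (heatK_nonneg d hτ z) (by positivity)

lemma abs_heatK_sub_mul_weight_le (d : ℕ) {T β u h : ℝ} (hβ0 : 0 < β) (hβ1 : β ≤ 1) (hu : 0 < u)
    (huT : u ≤ T) (h0 : 0 < h) (hhu : h ≤ u) (z : EuclideanSpace ℝ (Fin d)) :
    |heatK d (u + h) z - heatK d u z| * (1 + ‖z‖ ^ β) ≤
      32 * (1 + T) * (8 + d) * (h / u) * wideGauss d u z := by
  have hT : 0 < T := hu.trans_le huT
  have hmvt := (convex_Icc u (u + h)).norm_image_sub_le_of_norm_hasDerivWithin_le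
    (f := fun τ => heatK d τ z)
    (fun τ hτ => (hasDerivAt_heatK d (hu.trans_le hτ.1) z).hasDerivWithinAt)
    (fun τ hτ => abs_deriv_heatK_le d hu hτ.1 (by linarith [hτ.2]) z)
    (left_mem_Icc.2 (by linarith)) (right_mem_Icc.2 (by linarith))
  rw [norm_eq_abs, norm_eq_abs, add_sub_cancel_left, abs_of_pos h0] at hmvt
  have hw := one_add_rpow_le_exp hβ0 hβ1 hu huT (norm_nonneg z)
  have hy : 0 ≤ ‖z‖ ^ 2 / (32 * u) := by positivity
  have h1 : ‖z‖ ^ 2 / (4 * u ^ 2) + d / (2 * u) =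
      (8 * (‖z‖ ^ 2 / (32 * u)) + d / 2) * (1 / u) := by field_simp; ring
  have h2 : -‖z‖ ^ 2 / (8 * u) = -4 * (‖z‖ ^ 2 / (32 * u)) := by field_simp; ring
  have h3 : -(1 / (16 * u)) * ‖z‖ ^ 2 = -2 * (‖z‖ ^ 2 / (32 * u)) := by field_simp; ring
  unfold wideGauss
  rw [h1, h2] at hmvt
  rw [h3]
  generalize ‖z‖ ^ 2 / (32 * u) = y at *
  have hpoly : 8 * y + d / 2 ≤ (8 + d) * exp y := by
    have hd : (0 : ℝ) ≤ d := by positivity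
    nlinarith [mul_le_mul_of_nonneg_left (add_one_le_exp y) (by linarith : (0 : ℝ) ≤ 8 + d),
      mul_nonneg hd hy]
  have hexp : exp y * exp (-4 * y) * exp y = exp (-2 * y) := by
    rw [← exp_add, ← exp_add]; ring_nf
  calc |heatK d (u + h) z - heatK d u z| * (1 + ‖z‖ ^ β)
      ≤ ((8 * y + d / 2) * (1 / u) * ((4 * π * u) ^ (-(d : ℝ) / 2) * exp (-4 * y)) * h) *
          (32 * (1 + T) * exp y) := by
        apply mul_le_mul hmvt hw (by positivity)
        positivity
    _ ≤ (((8 + d) * exp y) * (1 / u) * ((4 * π * u) ^ (-(d : ℝ) / 2) * exp (-4 * y)) * h) *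
          (32 * (1 + T) * exp y) := by gcongr
    _ = 32 * (1 + T) * (8 + d) * (h / u) *
          ((4 * π * u) ^ (-(d : ℝ) / 2) * (exp y * exp (-4 * y) * exp y)) := by ring
    _ = _ := by rw [hexp]

/-- The weighted `L¹` modulus of continuity in time of the heat kernel. -/
lemma integral_abs_heatK_sub_mul_weight_le (d : ℕ) {T β u h : ℝ} (hβ0 : 0 < β) (hβ1 : β ≤ 1)
    (hu : 0 < u) (h0 : 0 < h) (huT : u + h ≤ T) :
    ∫ z : EuclideanSpace ℝ (Fin d), |heatK d (u + h) z - heatK d u z| * (1 + ‖z‖ ^ β) ≤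
      64 * (1 + T) * (8 + d) * (4 : ℝ) ^ ((d : ℝ) / 2) * (h / (u + h)) := by
  have hT : 0 < T := by linarith
  have hd : (0 : ℝ) ≤ d := by positivity
  have hnn : 0 ≤ᵐ[volume] fun z : EuclideanSpace ℝ (Fin d) =>
      |heatK d (u + h) z - heatK d u z| * (1 + ‖z‖ ^ β) :=
    Eventually.of_forall fun z => by positivity
  rcases le_total h u with hhu | huh
  · have hfrac : h / u ≤ 2 * (h / (u + h)) := by
      rw [← mul_div_assoc, div_le_div_iff₀ hu (by linarith)]
      nlinarith
    calc _ ≤ ∫ z, 32 * (1 + T) * (8 + d) * (h / u) * wideGauss d u z :=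
          integral_mono_of_nonneg hnn ((integrable_wideGauss d hu).const_mul _)
            (Eventually.of_forall
              (abs_heatK_sub_mul_weight_le d hβ0 hβ1 hu (by linarith) h0 hhu))
      _ = 32 * (1 + T) * (8 + d) * (4 : ℝ) ^ ((d : ℝ) / 2) * (h / u) := by
          rw [integral_const_mul, integral_wideGauss d hu]; ring
      _ ≤ 32 * (1 + T) * (8 + d) * (4 : ℝ) ^ ((d : ℝ) / 2) * (2 * (h / (u + h))) := by gcongr
      _ = _ := by ring
  · have huh0 : 0 < u + h := by linarith
    have hfrac : 1 ≤ 2 * (h / (u + h)) := by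
      rw [← mul_div_assoc, le_div_iff₀ huh0]
      linarith
    calc _ ≤ ∫ z, (32 * (1 + T) * wideGauss d (u + h) z + 32 * (1 + T) * wideGauss d u z) := by
          refine integral_mono_of_nonneg hnn
            (((integrable_wideGauss d huh0).const_mul _).add
              ((integrable_wideGauss d hu).const_mul _)) (Eventually.of_forall fun z => ?_)
          have hK := abs_sub (heatK d (u + h) z) (heatK d u z)
          rw [abs_of_nonneg (heatK_nonneg d huh0 z), abs_of_nonneg (heatK_nonneg d hu z)] at hK
          have hw : 0 ≤ 1 + ‖z‖ ^ β := by positivity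
          have := mul_le_mul_of_nonneg_right hK hw
          have h1 := heatK_mul_weight_le d hβ0 hβ1 huh0 huT z
          have h2 := heatK_mul_weight_le d hβ0 hβ1 hu (by linarith : u ≤ T) z
          simp only
          linarith
      _ = 32 * (1 + T) * 2 * (4 : ℝ) ^ ((d : ℝ) / 2) * 1 := by
          rw [integral_add ((integrable_wideGauss d huh0).const_mul _)
            ((integrable_wideGauss d hu).const_mul _), integral_const_mul, integral_const_mul,
            integral_wideGauss d hu, integral_wideGauss d huh0]
          ring
      _ ≤ 32 * (1 + T) * (8 + d) * (4 : ℝ) ^ ((d : ℝ) / 2) * (2 * (h / (u + h))) := by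
          gcongr
          linarith
      _ = _ := by ring

lemma hasDerivAt_sq_div_sub (c : ℝ) {t r : ℝ} (hr : r < t) :
    HasDerivAt (fun r => c ^ 2 / (t - r)) ((c / (t - r)) ^ 2) r := by
  have hne : t - r ≠ 0 := (sub_pos.2 hr).ne'
  refine ((hasDerivAt_const r (c ^ 2)).div ((hasDerivAt_id r).const_sub t) hne).congr_deriv ?_
  simp [div_pow]

lemma intervalIntegrable_sq_div_sub (c : ℝ) {s t : ℝ} (hs : 0 ≤ s) (hst : s < t) :
    IntervalIntegrable (fun r => (c / (t - r)) ^ 2) volume 0 s := by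
  apply ContinuousOn.intervalIntegrable
  intro r hr
  rw [uIcc_of_le hs] at hr
  have : t - r ≠ 0 := by linarith [hr.2]
  fun_prop (disch := assumption)

lemma integral_sq_div_sub_le (c : ℝ) {s t : ℝ} (hs : 0 ≤ s) (hst : s < t) :
    ∫ r in (0 : ℝ)..s, (c / (t - r)) ^ 2 ≤ c ^ 2 / (t - s) := by
  rw [intervalIntegral.integral_eq_sub_of_hasDerivAt (f := fun r => c ^ 2 / (t - r))
    (fun r hr => hasDerivAt_sq_div_sub c ?_) (intervalIntegrable_sq_div_sub c hs hst)]
  · have : 0 ≤ c ^ 2 / (t - 0) := by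
      have : 0 < t - 0 := by linarith
      positivity
    linarith
  · rw [uIcc_of_le hs] at hr
    exact hr.2.trans_lt hst

/-- Time-continuity estimate (hypothesis (2.2), `γ₁ = 1`) for the Gaussian heat
kernel: `∫_0^s (∫_{ℝ^d} |K(t-r,z) - K(s-r,z)| (1+|z|^β) dz)² dr ≤ N (t-s)`. -/
theorem statement6 (d : ℕ) (hd : 1 ≤ d) (T : ℝ) (hT : 0 < T)
    (β : ℝ) (hβ0 : 0 < β) (hβ1 : β ≤ 1) :
    ∃ N : ℝ, 0 < N ∧ ∀ s t : ℝ, 0 < s → s < t → t ≤ T →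
      ∫ r in (0:ℝ)..s,
          (∫ z : EuclideanSpace ℝ (Fin d),
            |heatK d (t - r) z - heatK d (s - r) z| * (1 + ‖z‖ ^ β)) ^ 2
        ≤ N * (t - s) := by
  set A : ℝ := 64 * (1 + T) * (8 + d) * (4 : ℝ) ^ ((d : ℝ) / 2) with hA
  have hA0 : 0 < A := by positivity
  refine ⟨A ^ 2, by positivity, fun s t hs hst htT => ?_⟩
  have hts : 0 < t - s := sub_pos.2 hst
  calc _ ≤ ∫ r in (0 : ℝ)..s, (A * (t - s) / (t - r)) ^ 2 := by
        have hint := intervalIntegrable_sq_div_sub (A * (t - s)) hs.le hst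
        rw [intervalIntegrable_iff_integrableOn_Ioo_of_le hs.le] at hint
        rw [intervalIntegral.integral_of_le hs.le, intervalIntegral.integral_of_le hs.le,
          integral_Ioc_eq_integral_Ioo, integral_Ioc_eq_integral_Ioo]
        refine integral_mono_of_nonneg (Eventually.of_forall fun r => by positivity) hint ?_
        filter_upwards [ae_restrict_mem measurableSet_Ioo] with r hr
        have hF := integral_abs_heatK_sub_mul_weight_le d (T := T) hβ0 hβ1 (sub_pos.2 hr.2) hts
          (by linarith [hr.1])
        rw [show s - r + (t - s) = t - r by ring, ← hA, ← mul_div_assoc] at hF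
        exact pow_le_pow_left₀ (integral_nonneg fun z => by positivity) hF 2
    _ ≤ (A * (t - s)) ^ 2 / (t - s) := integral_sq_div_sub_le _ hs.le hst
    _ = A ^ 2 * (t - s) := by field_simp
end
end

section
/- Let d ≥ 1, 0 < α ≤ 2, 0 ≤ ε < α/2, 0 ≤ β < α, C > 0 and T > 0. Let f : (0,∞) × ℝ^d → [0,∞) be measurable and satisfy f(t,z) ≤ C·|z|^ε·min( t/|z|^{d+α+2ε} , t^{−(d+2ε)/α} ) for all t > 0 and z ∈ ℝ^d. Then there is a constant N = N(d,α,ε,β,C,T) such that for all 0 ≤ s < t ≤ T: ∫_s^t ( ∫_{ℝ^d} f(t−r,z)·(1 + |z|^β) dz )² dr ≤ N·(t−s)^{1−2ε/α}. -/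
open MeasureTheory Real Set Filter
open scoped ENNReal NNReal Topology

noncomputable section

/-- The profile `min (y⁻ᵖ) 1` is dominated by a multiple of `(1 + y)⁻ᵖ`. -/
theorem min_one_div_rpow_one_le {y p : ℝ} (hy : 0 ≤ y) (hp : 0 < p) :
    min (1 / y ^ p) 1 ≤ 2 ^ p * (1 + y) ^ (-p) := by
  have h1 : 0 < 1 + y := by linarith
  rw [rpow_neg h1.le, ← div_eq_mul_inv, ← div_rpow zero_le_two h1.le]
  rcases le_total y 1 with h | h
  · refine (min_le_right _ _).trans (one_le_rpow ?_ hp.le)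
    rw [le_div_iff₀ h1]
    linarith
  · refine (min_le_left _ _).trans ?_
    have hy0 : 0 < y := by linarith
    rw [← one_rpow p, ← div_rpow zero_le_one hy, one_rpow]
    refine rpow_le_rpow (by positivity) ?_ hp.le
    rw [div_le_div_iff₀ hy0 h1]
    linarith

/-- Parabolic scaling of the kernel bound, with `l` playing the role of `t ^ (1 / α)`. -/
theorem kernel_bound_scaling {d α ε l y : ℝ} (hl : 0 < l) (hy : 0 ≤ y) :
    (l * y) ^ ε * min (l ^ α / (l * y) ^ (d + α + 2 * ε)) (l ^ (-(d + 2 * ε))) =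
      l ^ (-(d + ε)) * (y ^ ε * min (1 / y ^ (d + α + 2 * ε)) 1) := by
  have e1 : l ^ α / (l * y) ^ (d + α + 2 * ε) =
      l ^ (-(d + 2 * ε)) * (1 / y ^ (d + α + 2 * ε)) := by
    rw [mul_rpow hl.le hy, show -(d + 2 * ε) = α - (d + α + 2 * ε) by ring, rpow_sub hl,
      div_mul_div_comm, mul_one]
  have e2 : l ^ (-(d + ε)) = l ^ ε * l ^ (-(d + 2 * ε)) := by
    rw [← rpow_add hl]
    ring_nf
  rw [e1, e2, mul_rpow hl.le hy]
  nth_rewrite 2 [← mul_one (l ^ (-(d + 2 * ε)))]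
  rw [← mul_min_of_nonneg _ _ (rpow_nonneg hl.le _)]
  ring

/-- Weighted, rescaled pointwise kernel bound with an integrable profile. -/
theorem weighted_kernel_bound_le {d α ε β l L y : ℝ} (hp : 0 < d + α + 2 * ε) (hε : 0 ≤ ε)
    (hβ : 0 ≤ β) (hl : 0 < l) (hL : l ^ β ≤ L) (hy : 0 ≤ y) :
    (l * y) ^ ε * min (l ^ α / (l * y) ^ (d + α + 2 * ε)) (l ^ (-(d + 2 * ε))) *
        (1 + (l * y) ^ β) ≤
      l ^ (-(d + ε)) * (2 ^ (d + α + 2 * ε) * (1 + L)) *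
        (1 + y) ^ (-(d + α + ε - β)) := by
  have h1 : 0 < 1 + y := by linarith
  have hβy : y ^ β ≤ (1 + y) ^ β := rpow_le_rpow hy (by linarith) hβ
  have hw : 1 + (l * y) ^ β ≤ (1 + L) * (1 + y) ^ β := by
    rw [mul_rpow hl.le hy, add_mul, one_mul]
    refine add_le_add (one_le_rpow (by linarith) hβ) ?_
    exact mul_le_mul hL hβy (rpow_nonneg hy _) ((rpow_nonneg hl.le _).trans hL)
  have hm := min_one_div_rpow_one_le hy hp
  have hεy : y ^ ε ≤ (1 + y) ^ ε := rpow_le_rpow hy (by linarith) hε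
  have e : (1 + y) ^ (-(d + α + ε - β)) =
      (1 + y) ^ ε * (1 + y) ^ (-(d + α + 2 * ε)) * (1 + y) ^ β := by
    rw [← rpow_add h1, ← rpow_add h1]
    ring_nf
  rw [kernel_bound_scaling hl hy, e]
  calc l ^ (-(d + ε)) * (y ^ ε * min (1 / y ^ (d + α + 2 * ε)) 1) * (1 + (l * y) ^ β)
      ≤ l ^ (-(d + ε)) * ((1 + y) ^ ε * (2 ^ (d + α + 2 * ε) * (1 + y) ^ (-(d + α + 2 * ε)))) *
          ((1 + L) * (1 + y) ^ β) := by
        gcongr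
    _ = _ := by ring

/-- The weighted integral of a function below the kernel bound at time `t ≤ T`. -/
theorem integral_weighted_le {d : ℕ} {α ε β C T t : ℝ} (hα : 0 < α) (hε : 0 ≤ ε)
    (hβ : 0 ≤ β) (hβα : β < α) (hC : 0 ≤ C) (ht : 0 < t) (htT : t ≤ T)
    {g : EuclideanSpace ℝ (Fin d) → ℝ} (hg0 : ∀ z, 0 ≤ g z)
    (hg : ∀ z, g z ≤ C * ‖z‖ ^ ε *
      min (t / ‖z‖ ^ ((d : ℝ) + α + 2 * ε)) (t ^ (-((d : ℝ) + 2 * ε) / α))) :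
    ∫ z, g z * (1 + ‖z‖ ^ β) ≤
      C * (2 ^ ((d : ℝ) + α + 2 * ε) * (1 + T ^ (β / α))) *
        (∫ w : EuclideanSpace ℝ (Fin d), (1 + ‖w‖) ^ (-((d : ℝ) + α + ε - β))) *
        t ^ (-ε / α) := by
  set l : ℝ := t ^ (1 / α) with hl_def
  have hl : 0 < l := rpow_pos_of_pos ht _
  have hpow (a : ℝ) : l ^ a = t ^ (a / α) := by
    rw [hl_def, ← rpow_mul ht.le, one_div_mul_eq_div]
  have hlα : l ^ α = t := by rw [hpow, div_self hα.ne', rpow_one]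
  have hL : l ^ β ≤ T ^ (β / α) := by
    rw [hpow]
    exact rpow_le_rpow ht.le htT (by positivity)
  have hint : Integrable fun w : EuclideanSpace ℝ (Fin d) ↦
      (1 + ‖w‖) ^ (-((d : ℝ) + α + ε - β)) :=
    integrable_one_add_norm (by rw [finrank_euclideanSpace_fin]; linarith)
  set K : ℝ := C * (l ^ (-((d : ℝ) + ε)) * (2 ^ ((d : ℝ) + α + 2 * ε) * (1 + T ^ (β / α))))
    with hK
  have hle : ∫ z, g z * (1 + ‖z‖ ^ β) ≤
      ∫ z : EuclideanSpace ℝ (Fin d), K * (1 + ‖l⁻¹ • z‖) ^ (-((d : ℝ) + α + ε - β)) := by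
    refine integral_mono_of_nonneg (.of_forall fun z ↦ ?_)
      ((hint.comp_smul (inv_ne_zero hl.ne')).const_mul K) (.of_forall fun z ↦ ?_)
    · have := hg0 z
      positivity
    · have hz : l * ‖l⁻¹ • z‖ = ‖z‖ := by
        rw [norm_smul, norm_inv, Real.norm_of_nonneg hl.le, mul_inv_cancel_left₀ hl.ne']
      have key := weighted_kernel_bound_le (d := d) (α := α) (y := ‖l⁻¹ • z‖) (by positivity)
        hε hβ hl hL (norm_nonneg _)
      rw [hz, hlα, hpow (-((d : ℝ) + 2 * ε))] at key
      calc g z * (1 + ‖z‖ ^ β)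
          ≤ C * ‖z‖ ^ ε * min (t / ‖z‖ ^ ((d : ℝ) + α + 2 * ε))
              (t ^ (-((d : ℝ) + 2 * ε) / α)) * (1 + ‖z‖ ^ β) := by
            gcongr
            exact hg z
        _ ≤ K * (1 + ‖l⁻¹ • z‖) ^ (-((d : ℝ) + α + ε - β)) := by
            rw [hK, mul_assoc C, mul_assoc C, mul_assoc C]
            exact mul_le_mul_of_nonneg_left key hC
  refine hle.trans_eq ?_
  rw [integral_const_mul, Measure.integral_comp_inv_smul_of_nonneg volume
    (fun w : EuclideanSpace ℝ (Fin d) ↦ (1 + ‖w‖) ^ (-((d : ℝ) + α + ε - β))) hl.le,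
    finrank_euclideanSpace_fin, smul_eq_mul, hK, ← hpow (-ε), ← rpow_natCast,
    show -ε = -((d : ℝ) + ε) + d by ring, rpow_add hl]
  ring

/-- Third estimate of Lemma 3.1: for nonnegative `f` dominated by the sharp
fractional-kernel bound of order `ε` and a weight `1 + |z|^β` with `β < α`,
`∫_s^t (∫_{ℝ^d} f(t-r,z)(1+|z|^β) dz)² dr ≤ N (t-s)^{1-2ε/α}`. -/
theorem statement12 (d : ℕ) (hd : 1 ≤ d) (α ε β C T : ℝ)
    (hα0 : 0 < α) (hα2 : α ≤ 2) (hε0 : 0 ≤ ε) (hε : ε < α / 2)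
    (hβ0 : 0 ≤ β) (hβ : β < α) (hC : 0 < C) (hT : 0 < T) :
    ∃ N : ℝ, 0 < N ∧ ∀ f : ℝ → EuclideanSpace ℝ (Fin d) → ℝ,
      Measurable (fun q : ℝ × EuclideanSpace ℝ (Fin d) => f q.1 q.2) →
      (∀ t : ℝ, 0 < t → ∀ z, 0 ≤ f t z) →
      (∀ t : ℝ, 0 < t → ∀ z, f t z ≤
        C * ‖z‖ ^ ε *
          min (t / ‖z‖ ^ ((d : ℝ) + α + 2 * ε)) (t ^ (-((d : ℝ) + 2 * ε) / α))) →
      ∀ s t : ℝ, 0 ≤ s → s < t → t ≤ T →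
        ∫ r in s..t,
            (∫ z : EuclideanSpace ℝ (Fin d), f (t - r) z * (1 + ‖z‖ ^ β)) ^ 2
          ≤ N * (t - s) ^ (1 - 2 * ε / α) := by
  set P : ℝ := C * (2 ^ ((d : ℝ) + α + 2 * ε) * (1 + T ^ (β / α))) *
    ∫ w : EuclideanSpace ℝ (Fin d), (1 + ‖w‖) ^ (-((d : ℝ) + α + ε - β)) with hP
  have hδ : 0 < 1 - 2 * ε / α := by
    rw [sub_pos, div_lt_one hα0]
    linarith
  have hexp : -1 < -(2 * ε / α) := by linarith
  refine ⟨P ^ 2 / (1 - 2 * ε / α) + 1, by positivity, fun f _ hf0 hf s t hs hst htT ↦ ?_⟩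
  have hts : 0 < t - s := sub_pos.2 hst
  have hmajor : IntervalIntegrable (fun r ↦ P ^ 2 * (t - r) ^ (-(2 * ε / α))) volume s t := by
    have := (intervalIntegral.intervalIntegrable_rpow' (a := t - s) (b := t - t)
      hexp).comp_sub_left t
    simpa using this.const_mul (P ^ 2)
  have hle : ∫ r in s..t,
      (∫ z : EuclideanSpace ℝ (Fin d), f (t - r) z * (1 + ‖z‖ ^ β)) ^ 2 ≤
        ∫ r in s..t, P ^ 2 * (t - r) ^ (-(2 * ε / α)) := by
    rw [intervalIntegral.integral_of_le hst.le, intervalIntegral.integral_of_le hst.le,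
      integral_Ioc_eq_integral_Ioo, integral_Ioc_eq_integral_Ioo]
    rw [intervalIntegrable_iff_integrableOn_Ioo_of_le hst.le] at hmajor
    refine integral_mono_of_nonneg (.of_forall fun r ↦ sq_nonneg _) hmajor ?_
    filter_upwards [ae_restrict_mem measurableSet_Ioo] with r hr
    have hr0 : 0 < t - r := sub_pos.2 hr.2
    have hb := integral_weighted_le hα0 hε0 hβ0 hβ hC.le hr0
      (show t - r ≤ T by linarith [hr.1]) (hf0 _ hr0) (hf _ hr0)
    have h0 : 0 ≤ ∫ z : EuclideanSpace ℝ (Fin d), f (t - r) z * (1 + ‖z‖ ^ β) :=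
      integral_nonneg fun z ↦ mul_nonneg (hf0 _ hr0 z) (by positivity)
    refine (pow_le_pow_left₀ h0 hb 2).trans_eq ?_
    rw [← hP, mul_pow, ← rpow_mul_natCast hr0.le]
    congr 2
    push_cast
    ring
  refine hle.trans ?_
  rw [intervalIntegral.integral_const_mul,
    intervalIntegral.integral_comp_sub_left (fun x : ℝ ↦ x ^ (-(2 * ε / α))) t, sub_self,
    integral_rpow (.inl hexp), neg_add_eq_sub, zero_rpow hδ.ne', sub_zero, add_mul, one_mul,
    mul_div_assoc', mul_comm_div, ← mul_div_assoc]
  exact le_add_of_nonneg_right (by positivity)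

end
end
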